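/- arXiv:2510.12520 — 3 statements merged into one kernel-verified Lean document; each statement's English description precedes it below -/
import Mathlib

section
/- (A. Markov's inequality on an interval) For every a > 0, every integer q ≥ 1, and every real polynomial f of degree at most q, the derivative satisfies sup_{x∈[0,a]} |f'(x)| ≤ (2q²/a) · sup_{x∈[0,a]} |f(x)|. -/
/-!
Statement 8 (A. Markov's inequality on an interval): for every `a > 0`, every `q ≥ 1` and every
real polynomial `f` of degree at most `q`,
`sup_{x ∈ [0,a]} |f'(x)| ≤ (2 q² / a) · sup_{x ∈ [0,a]} |f(x)|`.
-/

open Polynomial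

/-- A sequence that is affine on `{0, …, p + 1}`, has second difference `2` at `p + 1` and is
antiperiodic with antiperiod `p + 1` is determined. -/
lemma eq_of_second_difference_of_antiperiodic {p : ℕ} {c : ℕ → ℂ}
    (h : ∀ j < p, c (j + 2) - 2 * c (j + 1) + c j = 0)
    (hp : c (p + 2) - 2 * c (p + 1) + c p = 2)
    (h0 : c (p + 1) = -c 0) (h1 : c (p + 2) = -c 1) {j : ℕ} (hj : j ≤ p + 1) :
    c j = (p + 1) / 2 - j := by
  have affine : ∀ j ≤ p, c j = c 0 + j * (c 1 - c 0) ∧ c (j + 1) = c 0 + (j + 1) * (c 1 - c 0) := by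
    intro j
    induction j with
    | zero => intro _; simp
    | succ j ih =>
      intro hj
      obtain ⟨ih₁, ih₂⟩ := ih (by omega)
      refine ⟨by push_cast; exact ih₂, ?_⟩
      push_cast
      linear_combination h j (by omega) + 2 * ih₂ - ih₁
  obtain ⟨hp₁, hp₂⟩ := affine p le_rfl
  have slope : c 1 - c 0 = -1 := by linear_combination (h1 - hp + hp₁ - hp₂ - h0) / 2
  have start : c 0 = (p + 1) / 2 := by
    rw [slope] at hp₂
    linear_combination (h0 - hp₂) / 2
  have hcj : c j = c 0 + j * (c 1 - c 0) := by
    rcases j with _ | j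
    · simp
    · exact_mod_cast (affine j (by omega)).2
  rw [hcj, slope, start]
  ring

/-- The angles whose exponentials are the `2n`-th roots of `-1`. -/
noncomputable def rieszAngle (n k : ℕ) : ℝ := (2 * k + 1) * Real.pi / (2 * n)

/-- The absolute values of the weights in Riesz's interpolation formula. -/
noncomputable def rieszWeight (n k : ℕ) : ℝ := 1 / (2 * n * (1 - Real.cos (rieszAngle n k)))

lemma cos_rieszAngle_lt_one {n k : ℕ} (hk : k < 2 * n) : Real.cos (rieszAngle n k) < 1 := by
  have hn : (0 : ℝ) < n := by
    have : 0 < n := by omega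
    exact_mod_cast this
  have hk' : (k : ℝ) + 1 ≤ 2 * n := by exact_mod_cast hk
  have hpi := Real.pi_pos
  have hpos : 0 < rieszAngle n k := by unfold rieszAngle; positivity
  refine lt_of_le_of_ne (Real.cos_le_one _) fun h => hpos.ne' ?_
  refine (Real.cos_eq_one_iff_of_lt_of_lt (by linarith) ?_).1 h
  rw [rieszAngle, div_lt_iff₀ (by positivity)]
  nlinarith

lemma rieszWeight_nonneg (n k : ℕ) : 0 ≤ rieszWeight n k := by
  have := Real.cos_le_one (rieszAngle n k)
  unfold rieszWeight
  have : 0 ≤ 1 - Real.cos (rieszAngle n k) := by linarith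
  positivity

/-- The `2n`-th roots of `-1`. -/
noncomputable def rieszRoot (n k : ℕ) : ℂ := Complex.exp (rieszAngle n k * Complex.I)

lemma rieszRoot_pow (n k : ℕ) (hn : n ≠ 0) : rieszRoot n k ^ n = Complex.I * (-1) ^ k := by
  have hn' : (n : ℂ) ≠ 0 := by exact_mod_cast hn
  rw [rieszRoot, ← Complex.exp_nat_mul, rieszAngle]
  have : (n : ℂ) * (((2 * k + 1) * Real.pi / (2 * n) : ℝ) * Complex.I) =
      Real.pi / 2 * Complex.I + k * (Real.pi * Complex.I) := by
    push_cast
    field_simp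
    ring
  rw [this, Complex.exp_add, Complex.exp_nat_mul, Complex.exp_pi_mul_I,
    Complex.exp_pi_div_two_mul_I]

lemma rieszRoot_pow_two_mul (n k : ℕ) (hn : n ≠ 0) : rieszRoot n k ^ (2 * n) = -1 := by
  rw [mul_comm, pow_mul, rieszRoot_pow n k hn, mul_pow, Complex.I_sq, ← pow_mul, mul_comm k,
    pow_mul]
  simp

lemma sum_rieszRoot_pow {n j : ℕ} (hj0 : j ≠ 0) (hj : j < 2 * n) :
    ∑ k ∈ Finset.range (2 * n), rieszRoot n k ^ j = 0 := by
  have hn : n ≠ 0 := by omega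
  have hn' : (n : ℂ) ≠ 0 := by exact_mod_cast hn
  have hprim := Complex.isPrimitiveRoot_exp (2 * n) (by omega)
  set ζ := Complex.exp (2 * Real.pi * Complex.I / (2 * n : ℕ)) with hζ
  have hroot : ∀ k, rieszRoot n k = rieszRoot n 0 * ζ ^ k := by
    intro k
    rw [hζ, ← Complex.exp_nat_mul, rieszRoot, rieszRoot, ← Complex.exp_add, rieszAngle, rieszAngle]
    congr 1
    push_cast
    field_simp
    ring
  have hne : ζ ^ j ≠ 1 := hprim.pow_ne_one_of_pos_of_lt hj0 hj
  have hgeom : ∑ k ∈ Finset.range (2 * n), (ζ ^ j) ^ k = 0 := by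
    have := mul_geom_sum (ζ ^ j) (2 * n)
    rw [← pow_mul, mul_comm j, pow_mul, hprim.pow_eq_one, one_pow, sub_self] at this
    exact (mul_eq_zero.1 this).resolve_left (sub_ne_zero.2 hne)
  calc ∑ k ∈ Finset.range (2 * n), rieszRoot n k ^ j
      = ∑ k ∈ Finset.range (2 * n), rieszRoot n 0 ^ j * (ζ ^ j) ^ k := by
        refine Finset.sum_congr rfl fun k _ => ?_
        rw [hroot k, mul_pow, ← pow_mul, ← pow_mul, mul_comm k]
    _ = 0 := by rw [← Finset.mul_sum, hgeom, mul_zero]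

lemma rieszWeight_mul_rieszRoot {n k : ℕ} (hk : k < 2 * n) :
    (rieszWeight n k : ℂ) * (rieszRoot n k ^ 2 - 2 * rieszRoot n k + 1) = -rieszRoot n k / n := by
  have hn' : (n : ℂ) ≠ 0 := by
    have : n ≠ 0 := by omega
    exact_mod_cast this
  have hc : (1 - Complex.cos (rieszAngle n k) : ℂ) ≠ 0 := by
    have := (sub_pos.2 (cos_rieszAngle_lt_one hk)).ne'
    exact_mod_cast this
  have hquad : rieszRoot n k ^ 2 + 1 = 2 * Complex.cos (rieszAngle n k) * rieszRoot n k := by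
    rw [rieszRoot, Complex.exp_mul_I]
    linear_combination (-1 : ℂ) * Complex.sin_sq_add_cos_sq (rieszAngle n k) +
      Complex.sin (rieszAngle n k) ^ 2 * Complex.I_sq
  rw [show rieszRoot n k ^ 2 - 2 * rieszRoot n k + 1 =
    -(2 * (1 - Complex.cos (rieszAngle n k)) * rieszRoot n k) by linear_combination hquad]
  rw [rieszWeight]
  push_cast
  field_simp

lemma sum_rieszWeight_mul_rieszRoot_pow {n j : ℕ} (hn : n ≠ 0) (hj : j ≤ 2 * n) :
    ∑ k ∈ Finset.range (2 * n), (rieszWeight n k : ℂ) * rieszRoot n k ^ j = n - j := by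
  have hn' : (n : ℂ) ≠ 0 := by exact_mod_cast hn
  obtain ⟨p, hp⟩ : ∃ p, 2 * n = p + 1 := ⟨2 * n - 1, by omega⟩
  have hpn : ((p : ℂ) + 1) / 2 = n := by
    have : (2 * n : ℂ) = p + 1 := by exact_mod_cast hp
    rw [← this]
    ring
  set c : ℕ → ℂ := fun j => ∑ k ∈ Finset.range (2 * n), (rieszWeight n k : ℂ) * rieszRoot n k ^ j
    with hc
  have hdiff : ∀ j, c (j + 2) - 2 * c (j + 1) + c j =
      -(∑ k ∈ Finset.range (2 * n), rieszRoot n k ^ (j + 1)) / n := by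
    intro j
    rw [neg_div, Finset.sum_div, ← Finset.sum_neg_distrib, Finset.mul_sum,
      ← Finset.sum_sub_distrib, ← Finset.sum_add_distrib]
    refine Finset.sum_congr rfl fun k hk => ?_
    linear_combination rieszRoot n k ^ j * rieszWeight_mul_rieszRoot (Finset.mem_range.1 hk)
  have hanti : ∀ j, c (j + 2 * n) = -c j := by
    intro j
    rw [← Finset.sum_neg_distrib]
    refine Finset.sum_congr rfl fun k _ => ?_
    rw [pow_add, rieszRoot_pow_two_mul n k hn]
    ring
  change c j = n - j
  rw [← hpn]
  refine eq_of_second_difference_of_antiperiodic (p := p) (fun j hj => ?_) ?_ ?_ ?_ (hp ▸ hj)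
  · rw [hdiff, sum_rieszRoot_pow (by omega) (by omega)]
    simp
  · rw [hdiff, ← hp]
    simp_rw [rieszRoot_pow_two_mul n _ hn]
    simp
    field_simp
  · rw [← hp, ← hanti 0, zero_add]
  · rw [← hanti 1, hp]
    congr 1
    omega

lemma sum_rieszWeight {n : ℕ} (hn : n ≠ 0) :
    ∑ k ∈ Finset.range (2 * n), rieszWeight n k = n := by
  have := sum_rieszWeight_mul_rieszRoot_pow hn (Nat.zero_le (2 * n))
  simp only [pow_zero, mul_one, Nat.cast_zero, sub_zero] at this
  exact_mod_cast this

/-- **Riesz's interpolation formula** for the exponentials `exp (i m θ)`, `0 ≤ m ≤ n`. -/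
lemma riesz_interpolation_exp {n m : ℕ} (hn : n ≠ 0) (hm : m ≤ n) (θ : ℝ) :
    ∑ k ∈ Finset.range (2 * n), (((-1) ^ k * rieszWeight n k : ℝ) : ℂ) *
      Complex.exp ((m * (θ + rieszAngle n k) : ℝ) * Complex.I) =
      Complex.I * m * Complex.exp ((m * θ : ℝ) * Complex.I) := by
  have h := sum_rieszWeight_mul_rieszRoot_pow hn (show n + m ≤ 2 * n by omega)
  have hterm : ∀ k, (((-1) ^ k * rieszWeight n k : ℝ) : ℂ) *
      Complex.exp ((m * (θ + rieszAngle n k) : ℝ) * Complex.I) =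
      -Complex.I * Complex.exp ((m * θ : ℝ) * Complex.I) *
        (rieszWeight n k * rieszRoot n k ^ (n + m)) := by
    intro k
    have hexp : Complex.exp ((m * (θ + rieszAngle n k) : ℝ) * Complex.I) =
        Complex.exp ((m * θ : ℝ) * Complex.I) * rieszRoot n k ^ m := by
      rw [rieszRoot, ← Complex.exp_nat_mul, ← Complex.exp_add]
      congr 1
      push_cast
      ring
    rw [hexp, pow_add, rieszRoot_pow n k hn]
    push_cast
    linear_combination (-1 : ℂ) ^ k * rieszWeight n k * Complex.exp ((m * θ : ℂ) * Complex.I) *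
      rieszRoot n k ^ m * Complex.I_sq
  rw [Finset.sum_congr rfl fun k _ => hterm k, ← Finset.mul_sum, h]
  push_cast
  ring

lemma riesz_interpolation_cos {n m : ℕ} (hn : n ≠ 0) (hm : m ≤ n) (θ : ℝ) :
    ∑ k ∈ Finset.range (2 * n), (-1) ^ k * rieszWeight n k *
      Real.cos (m * (θ + rieszAngle n k)) = -(m * Real.sin (m * θ)) := by
  have h := congrArg Complex.re (riesz_interpolation_exp hn hm θ)
  rw [Complex.re_sum] at h
  simp_rw [Complex.re_ofReal_mul, Complex.exp_ofReal_mul_I_re] at h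
  rw [h, mul_assoc, Complex.I_mul_re, ← Complex.ofReal_natCast, Complex.im_ofReal_mul,
    Complex.exp_ofReal_mul_I_im]

lemma riesz_interpolation_sin {n m : ℕ} (hn : n ≠ 0) (hm : m ≤ n) (θ : ℝ) :
    ∑ k ∈ Finset.range (2 * n), (-1) ^ k * rieszWeight n k *
      Real.sin (m * (θ + rieszAngle n k)) = m * Real.cos (m * θ) := by
  have h := congrArg Complex.im (riesz_interpolation_exp hn hm θ)
  rw [Complex.im_sum] at h
  simp_rw [Complex.im_ofReal_mul, Complex.exp_ofReal_mul_I_im] at h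
  rw [h, mul_assoc, Complex.I_mul_im, ← Complex.ofReal_natCast, Complex.re_ofReal_mul,
    Complex.exp_ofReal_mul_I_re]

lemma mem_span_chebyshev_T (n : ℕ) {P : ℝ[X]} (hP : P.natDegree ≤ n) :
    P ∈ Submodule.span ℝ ((fun m : ℕ => Chebyshev.T ℝ m) '' Set.Iic n) := by
  induction n generalizing P with
  | zero =>
    rw [eq_C_of_natDegree_le_zero hP, ← mul_one (C _), ← smul_eq_C_mul]
    exact Submodule.smul_mem _ _ (Submodule.subset_span ⟨0, by simp, by simp⟩)
  | succ n ih =>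
    set T := Chebyshev.T ℝ ((n + 1 : ℕ) : ℤ) with hT
    have hdeg : T.natDegree = n + 1 := by
      rw [hT, Chebyshev.natDegree_T, Int.natAbs_natCast]
    have hlead : T.coeff (n + 1) ≠ 0 := by
      rw [← hdeg, coeff_natDegree, leadingCoeff_ne_zero]
      exact Chebyshev.T_ne_zero ℝ _
    set r := P.coeff (n + 1) / T.coeff (n + 1) with hr
    have hrem : (P - r • T).natDegree ≤ n := by
      rw [natDegree_le_iff_coeff_eq_zero]
      intro N hN
      rcases (Nat.succ_le_of_lt hN).eq_or_lt with rfl | hN'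
      · simp [hr, hlead]
      · rw [coeff_sub, coeff_smul, coeff_eq_zero_of_natDegree_lt (hP.trans_lt hN'),
          coeff_eq_zero_of_natDegree_lt (hdeg.trans_lt hN')]
        simp
    rw [← sub_add_cancel P (r • T)]
    refine Submodule.add_mem _ (Submodule.span_mono (Set.image_mono ?_) (ih hrem))
      (Submodule.smul_mem _ _ (Submodule.subset_span ⟨n + 1, by simp, rfl⟩))
    exact Set.Iic_subset_Iic.2 (Nat.le_succ n)

lemma eval_derivative_chebyshev_T_cos_mul_sin (m : ℕ) (θ : ℝ) :
    (derivative (Chebyshev.T ℝ m)).eval (Real.cos θ) * Real.sin θ = m * Real.sin (m * θ) := by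
  have h := Chebyshev.U_real_cos θ (m - 1)
  push_cast at h
  rw [sub_add_cancel] at h
  rw [Chebyshev.T_derivative_eq_U, eval_mul, mul_assoc, h]
  simp

/-- Riesz's interpolation formula for the trigonometric polynomial `P (cos θ)`. -/
lemma eval_derivative_cos_mul_sin_eq_sum {n : ℕ} (hn : n ≠ 0) {P : ℝ[X]} (hP : P.natDegree ≤ n)
    (θ : ℝ) :
    (derivative P).eval (Real.cos θ) * Real.sin θ =
      -∑ k ∈ Finset.range (2 * n), (-1) ^ k * rieszWeight n k *
        P.eval (Real.cos (θ + rieszAngle n k)) := by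
  have hspan := mem_span_chebyshev_T n hP
  clear hP
  induction hspan using Submodule.span_induction with
  | mem x hx =>
    obtain ⟨m, hm, rfl⟩ := hx
    simp only [Chebyshev.T_real_cos, Int.cast_natCast]
    rw [riesz_interpolation_cos hn hm, eval_derivative_chebyshev_T_cos_mul_sin, neg_neg]
  | zero => simp
  | add x y _ _ hx hy =>
    simp only [derivative_add, eval_add, add_mul, mul_add, Finset.sum_add_distrib, neg_add, hx, hy]
  | smul r x _ hx =>
    simp only [derivative_smul, eval_smul, smul_eq_mul, mul_assoc, hx]
    simp only [mul_neg, Finset.mul_sum]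
    congr 1
    refine Finset.sum_congr rfl fun k _ => ?_
    ring

/-- Riesz's interpolation formula at `0` for the trigonometric polynomial `(derivative P) (cos θ) * sin θ`. -/
lemma eval_derivative_one_eq_sum {n : ℕ} (hn : n ≠ 0) {P : ℝ[X]} (hP : P.natDegree ≤ n) :
    (derivative P).eval 1 =
      ∑ k ∈ Finset.range (2 * n), (-1) ^ k * rieszWeight n k *
        ((derivative P).eval (Real.cos (rieszAngle n k)) * Real.sin (rieszAngle n k)) := by
  have hspan := mem_span_chebyshev_T n hP
  clear hP
  induction hspan using Submodule.span_induction with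
  | mem x hx =>
    obtain ⟨m, hm, rfl⟩ := hx
    have h := riesz_interpolation_sin hn hm 0
    simp only [zero_add, mul_zero, Real.cos_zero, mul_one] at h
    simp only [eval_derivative_chebyshev_T_cos_mul_sin, Chebyshev.derivative_T_eval_one,
      Int.cast_natCast]
    simp_rw [mul_left_comm _ (m : ℝ)]
    rw [← Finset.mul_sum, h, sq]
  | zero => simp
  | add x y _ _ hx hy =>
    simp only [derivative_add, eval_add, add_mul, mul_add, Finset.sum_add_distrib, hx, hy]
  | smul r x _ hx =>
    simp only [derivative_smul, eval_smul, smul_eq_mul, hx, Finset.mul_sum]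
    refine Finset.sum_congr rfl fun k _ => ?_
    ring

lemma abs_sum_rieszWeight_le {n : ℕ} (hn : n ≠ 0) {g : ℕ → ℝ} {M : ℝ} (hg : ∀ k, |g k| ≤ M) :
    |∑ k ∈ Finset.range (2 * n), (-1) ^ k * rieszWeight n k * g k| ≤ n * M := by
  rw [← sum_rieszWeight hn, Finset.sum_mul]
  refine (Finset.abs_sum_le_sum_abs _ _).trans (Finset.sum_le_sum fun k _ => ?_)
  rw [abs_mul, abs_mul, abs_neg_one_pow, one_mul, abs_of_nonneg (rieszWeight_nonneg n k)]
  exact mul_le_mul_of_nonneg_left (hg k) (rieszWeight_nonneg n k)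

/-- **Bernstein's inequality** for `P (cos θ)`. -/
lemma abs_eval_derivative_cos_mul_sin_le {n : ℕ} (hn : n ≠ 0) {P : ℝ[X]} (hP : P.natDegree ≤ n)
    {M : ℝ} (hM : ∀ x ∈ Set.Icc (-1 : ℝ) 1, |P.eval x| ≤ M) (θ : ℝ) :
    |(derivative P).eval (Real.cos θ) * Real.sin θ| ≤ n * M := by
  rw [eval_derivative_cos_mul_sin_eq_sum hn hP, abs_neg]
  exact abs_sum_rieszWeight_le hn fun k => hM _ (Real.cos_mem_Icc _)

/-- **Bernstein's inequality** on `[-1, 1]`. -/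
lemma abs_eval_derivative_mul_sqrt_le {n : ℕ} (hn : n ≠ 0) {P : ℝ[X]} (hP : P.natDegree ≤ n)
    {M : ℝ} (hM : ∀ x ∈ Set.Icc (-1 : ℝ) 1, |P.eval x| ≤ M) {x : ℝ} (hx : x ∈ Set.Icc (-1 : ℝ) 1) :
    |(derivative P).eval x| * √(1 - x ^ 2) ≤ n * M := by
  have h := abs_eval_derivative_cos_mul_sin_le hn hP hM (Real.arccos x)
  rwa [Real.cos_arccos hx.1 hx.2, Real.sin_arccos, abs_mul, abs_of_nonneg (Real.sqrt_nonneg _)] at h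

/-- **Markov's inequality** on `[-1, 1]`. -/
theorem abs_eval_derivative_le_of_forall_abs_le {n : ℕ} (hn : n ≠ 0) {P : ℝ[X]}
    (hP : P.natDegree ≤ n) {M : ℝ} (hM : ∀ x ∈ Set.Icc (-1 : ℝ) 1, |P.eval x| ≤ M) {x : ℝ}
    (hx : x ∈ Set.Icc (-1 : ℝ) 1) : |(derivative P).eval x| ≤ (n : ℝ) ^ 2 * M := by
  rcases eq_or_ne x 0 with rfl | hx0
  · have hM0 : 0 ≤ M := (abs_nonneg _).trans (hM 0 hx)
    have h := abs_eval_derivative_mul_sqrt_le hn hP hM hx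
    have hn1 : (1 : ℝ) ≤ n := by exact_mod_cast Nat.one_le_iff_ne_zero.2 hn
    simp only [ne_eq, OfNat.ofNat_ne_zero, not_false_eq_true, zero_pow, sub_zero, Real.sqrt_one,
      mul_one] at h
    exact h.trans (mul_le_mul_of_nonneg_right (le_self_pow₀ hn1 two_ne_zero) hM0)
  · have hderiv : ∀ y, (derivative (P.comp (C x * X))).eval y =
        x * (derivative P).eval (x * y) := by
      intro y
      simp [derivative_comp]
    have hdeg : (P.comp (C x * X)).natDegree ≤ n := by
      rw [natDegree_comp, natDegree_C_mul_X x hx0, mul_one]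
      exact hP
    have hx1 : x ^ 2 ≤ 1 := by nlinarith [hx.1, hx.2]
    have hbound : ∀ φ : ℝ, |(derivative (P.comp (C x * X))).eval (Real.cos φ) * Real.sin φ| ≤
        |x| * (n * M) := by
      intro φ
      have hcos := Real.cos_mem_Icc φ
      have hmem : x * Real.cos φ ∈ Set.Icc (-1 : ℝ) 1 := by
        rw [Set.mem_Icc, ← abs_le, abs_mul]
        exact mul_le_one₀ (abs_le.2 hx) (abs_nonneg _) (abs_le.2 hcos)
      have hsin : |Real.sin φ| ≤ √(1 - (x * Real.cos φ) ^ 2) := by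
        refine Real.abs_le_sqrt ?_
        nlinarith [Real.sin_sq_add_cos_sq φ, sq_nonneg (Real.cos φ)]
      rw [hderiv, abs_mul, abs_mul, mul_assoc]
      refine mul_le_mul_of_nonneg_left ?_ (abs_nonneg x)
      exact (mul_le_mul_of_nonneg_left hsin (abs_nonneg _)).trans
        (abs_eval_derivative_mul_sqrt_le hn hP hM hmem)
    have h := abs_sum_rieszWeight_le hn fun k => hbound (rieszAngle n k)
    rw [← eval_derivative_one_eq_sum hn hdeg, hderiv, mul_one, abs_mul] at h
    refine le_of_mul_le_mul_left (h.trans_eq ?_) (abs_pos.2 hx0)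
    ring

/-- **Markov's polynomial inequality** on the interval `[0, a]`. -/
theorem markov_inequality (a : ℝ) (ha : 0 < a) (q : ℕ) (hq : 1 ≤ q)
    (f : Polynomial ℝ) (hf : f.natDegree ≤ q) :
    sSup ((fun x => |(Polynomial.derivative f).eval x|) '' Set.Icc 0 a) ≤
      (2 * (q : ℝ) ^ 2 / a) * sSup ((fun x => |f.eval x|) '' Set.Icc 0 a) := by
  have hbdd : BddAbove ((fun x => |f.eval x|) '' Set.Icc 0 a) :=
    isCompact_Icc.bddAbove_image f.continuous.abs.continuousOn
  refine csSup_le ((Set.nonempty_Icc.2 ha.le).image _) ?_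
  rintro _ ⟨x, hx, rfl⟩
  set M := sSup ((fun x => |f.eval x|) '' Set.Icc 0 a)
  have hdeg : (f.comp (C (a / 2) * (X + 1))).natDegree ≤ q := by
    refine natDegree_comp_le.trans ((Nat.mul_le_mul hf ?_).trans_eq (mul_one q))
    compute_degree
  have hM : ∀ y ∈ Set.Icc (-1 : ℝ) 1, |(f.comp (C (a / 2) * (X + 1))).eval y| ≤ M := by
    intro y hy
    refine le_csSup hbdd ⟨a / 2 * (y + 1), ⟨?_, ?_⟩, by simp⟩ <;> nlinarith [hy.1, hy.2]
  have hmem : 2 * x / a - 1 ∈ Set.Icc (-1 : ℝ) 1 := by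
    have h0 : 0 ≤ 2 * x / a := div_nonneg (by linarith [hx.1]) ha.le
    have h2 : 2 * x / a ≤ 2 := (div_le_iff₀ ha).2 (by linarith [hx.2])
    constructor <;> linarith
  have h := abs_eval_derivative_le_of_forall_abs_le (Nat.one_le_iff_ne_zero.1 hq) hdeg hM hmem
  have hx' : a / 2 * (2 * x / a - 1 + 1) = x := by field_simp; ring
  have hderiv : (derivative (f.comp (C (a / 2) * (X + 1)))).eval (2 * x / a - 1) =
      a / 2 * (derivative f).eval x := by
    rw [derivative_comp, eval_mul, eval_comp]
    simp only [eval_mul, eval_C, eval_add, eval_X, eval_one, hx']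
    simp
  rw [hderiv, abs_mul, abs_of_pos (half_pos ha)] at h
  rw [div_mul_eq_mul_div, le_div_iff₀ ha]
  linarith
end

section
/- There is a universal constant C > 0 with the following property: for every integer q ≥ 1, every M ≥ 0, and every real polynomial Φ of degree at most q such that |Φ(1/N)| ≤ M for every positive integer N, one has |Φ'(0)| ≤ C · q⁴ · M. -/
open Polynomial

/-- Markov's inequality at the right endpoint of `[-1, 1]`. -/
lemma abs_eval_one_derivative_le {n : ℕ} {P : ℝ[X]} (hP : P.natDegree ≤ n)
    (h : ∀ x ∈ Set.Icc (-1 : ℝ) 1, |P.eval x| ≤ 1) :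
    |(derivative P).eval 1| ≤ (n : ℝ) ^ 2 := by
  have key : ∀ Q : ℝ[X], Q.natDegree ≤ n → (∀ x ∈ Set.Icc (-1 : ℝ) 1, |Q.eval x| ≤ 1) →
      (derivative Q).eval 1 ≤ (n : ℝ) ^ 2 := fun Q hQ hQb => by
    have := Chebyshev.eval_iterate_derivative_le_of_forall_abs_le_one (k := 1) le_rfl
      (natDegree_le_iff_degree_le.mp hQ) hQb
    simpa [Chebyshev.derivative_T_eval_one] using this
  refine abs_le.mpr ⟨?_, key P hP h⟩
  have := key (-P) (by simpa using hP) (by simpa using h)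
  simp only [derivative_neg, eval_neg] at this
  linarith

/-- Markov's inequality at the endpoint `c + r` of the interval with centre `c` and radius `|r|`;
a negative `r` gives the left endpoint. -/
lemma abs_mul_abs_eval_add_derivative_le {n : ℕ} {P : ℝ[X]} (hP : P.natDegree ≤ n) {A c r : ℝ}
    (hA : 0 < A) (h : ∀ t ∈ Set.Icc (-1 : ℝ) 1, |P.eval (c + r * t)| ≤ A) :
    |r| * |(derivative P).eval (c + r)| ≤ (n : ℝ) ^ 2 * A := by
  have hdeg : (C A⁻¹ * P.comp (C c + C r * X)).natDegree ≤ n := by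
    refine (natDegree_C_mul_le _ _).trans (natDegree_comp_le.trans ?_)
    have : (C c + C r * X).natDegree ≤ 1 := by compute_degree
    nlinarith
  have := abs_eval_one_derivative_le hdeg fun t ht => by
    simpa [abs_mul, abs_of_pos hA, inv_mul_le_iff₀ hA] using h t ht
  simp only [derivative_C_mul, derivative_comp, derivative_add, derivative_C, derivative_X,
    eval_mul, eval_C, eval_comp, eval_add, eval_X, mul_one, zero_add, abs_mul, abs_inv,
    abs_of_pos hA] at this
  rw [inv_mul_le_iff₀ hA] at this
  linarith

lemma abs_eval_right_derivative_le {n : ℕ} {P : ℝ[X]} (hP : P.natDegree ≤ n) {A a b : ℝ}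
    (hA : 0 < A) (hab : a ≤ b) (h : ∀ x ∈ Set.Icc a b, |P.eval x| ≤ A) :
    (b - a) * |(derivative P).eval b| ≤ 2 * (n : ℝ) ^ 2 * A := by
  have := abs_mul_abs_eval_add_derivative_le hP (c := (a + b) / 2) (r := (b - a) / 2) hA
    fun t ht => h _ ⟨by nlinarith [ht.1, ht.2], by nlinarith [ht.1, ht.2]⟩
  rw [abs_of_nonneg (by linarith), show (a + b) / 2 + (b - a) / 2 = b by ring] at this
  linarith

lemma abs_eval_left_derivative_le {n : ℕ} {P : ℝ[X]} (hP : P.natDegree ≤ n) {A a b : ℝ}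
    (hA : 0 < A) (hab : a ≤ b) (h : ∀ x ∈ Set.Icc a b, |P.eval x| ≤ A) :
    (b - a) * |(derivative P).eval a| ≤ 2 * (n : ℝ) ^ 2 * A := by
  have := abs_mul_abs_eval_add_derivative_le hP (c := (a + b) / 2) (r := (a - b) / 2) hA
    fun t ht => h _ ⟨by nlinarith [ht.1, ht.2], by nlinarith [ht.1, ht.2]⟩
  rw [abs_of_nonpos (by linarith), show (a + b) / 2 + (a - b) / 2 = a by ring] at this
  linarith

/-- Markov's inequality on `[a, b]`, up to a factor `2`: apply the endpoint inequality to the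
longer of the two intervals into which the point divides `[a, b]`. -/
lemma abs_eval_derivative_le_of_mem_Icc {n : ℕ} {P : ℝ[X]} (hP : P.natDegree ≤ n) {A a b x : ℝ}
    (hA : 0 < A) (h : ∀ y ∈ Set.Icc a b, |P.eval y| ≤ A) (hx : x ∈ Set.Icc a b) :
    (b - a) * |(derivative P).eval x| ≤ 4 * (n : ℝ) ^ 2 * A := by
  have h₁ := abs_eval_right_derivative_le hP hA hx.1 fun y hy => h y ⟨hy.1, hy.2.trans hx.2⟩
  have h₂ := abs_eval_left_derivative_le hP hA hx.2 fun y hy => h y ⟨hx.1.trans hy.1, hy.2⟩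
  linarith

lemma exists_inv_nat_near {K : ℕ} (hK : 0 < K) {x : ℝ} (hx : x ∈ Set.Icc (0 : ℝ) (1 / K)) :
    ∃ N : ℕ, 0 < N ∧ 1 / (N : ℝ) ∈ Set.Icc (0 : ℝ) (1 / K) ∧ |x - 1 / N| ≤ (1 / K : ℝ) ^ 2 := by
  have hK' : (0 : ℝ) < K := by exact_mod_cast hK
  have hle : ∀ N : ℕ, K ≤ N → 1 / (N : ℝ) ≤ 1 / K := fun N hN => by gcongr
  rcases le_or_gt x ((1 / K : ℝ) ^ 2) with hs | hs
  · refine ⟨K ^ 2, by positivity, ⟨by positivity, hle _ (by nlinarith)⟩, ?_⟩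
    have : (1 / ((K ^ 2 : ℕ) : ℝ)) = (1 / K : ℝ) ^ 2 := by simp
    rw [this, abs_le]
    constructor <;> linarith [hx.1]
  · have hx0 : 0 < x := lt_of_le_of_lt (by positivity) hs
    have hKN : K ≤ ⌊1 / x⌋₊ := Nat.le_floor ((le_one_div hK' hx0).mpr hx.2)
    have hN0 : 0 < ⌊1 / x⌋₊ := hK.trans_le hKN
    have h₁ := Nat.floor_le (one_div_nonneg.mpr hx0.le)
    have h₂ := Nat.lt_floor_add_one (1 / x)
    generalize ⌊1 / x⌋₊ = N at *
    have hN0' : (0 : ℝ) < N := by exact_mod_cast hN0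
    have h₁' : x ≤ 1 / N := (le_one_div hN0' hx0).mp h₁
    have h₂' : 1 / ((N : ℝ) + 1) < x := (one_div_lt hx0 (by positivity)).mp h₂
    refine ⟨N, hN0, ⟨by positivity, hle N hKN⟩, ?_⟩
    rw [abs_sub_comm, abs_of_nonneg (by linarith)]
    calc 1 / (N : ℝ) - x ≤ 1 / N - 1 / ((N : ℝ) + 1) := by linarith
      _ = 1 / N * (1 / ((N : ℝ) + 1)) := by field_simp; ring
      _ ≤ 1 / K * (1 / K) := by
        have : (K : ℝ) ≤ N := by exact_mod_cast hKN
        gcongr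
        linarith
      _ = (1 / K : ℝ) ^ 2 := by ring

/-- A polynomial bounded by `M` on the points `1 / N` is bounded by `2 * M` on an interval
`[0, 1 / (8 * q ^ 2)]`. -/
lemma abs_eval_le_two_mul_of_bounded_on_inv_nat {q : ℕ} (hq : 1 ≤ q) {M : ℝ} (hM : 0 ≤ M)
    {P : ℝ[X]} (hP : P.natDegree ≤ q) (h : ∀ N : ℕ, 0 < N → |P.eval (1 / (N : ℝ))| ≤ M)
    {x : ℝ} (hx : x ∈ Set.Icc (0 : ℝ) (1 / (8 * q ^ 2 : ℕ))) : |P.eval x| ≤ 2 * M := by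
  have hK : 0 < 8 * q ^ 2 := by positivity
  obtain ⟨y, hy, hmax⟩ := isCompact_Icc.exists_isMaxOn ⟨x, hx⟩ P.continuous.abs.continuousOn
  have hmax' := isMaxOn_iff.mp hmax
  refine (hmax' x hx).trans ?_
  rcases (abs_nonneg (P.eval y)).eq_or_lt with h0 | hA
  · rw [← h0]; positivity
  obtain ⟨N, hN, hNmem, hdist⟩ := exists_inv_nat_near hK hy
  have hder : ∀ z ∈ Set.Icc (0 : ℝ) (1 / (8 * q ^ 2 : ℕ)),
      ‖(derivative P).eval z‖ ≤ (8 * q ^ 2 : ℕ) * (4 * (q : ℝ) ^ 2 * |P.eval y|) := fun z hz => by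
    have := abs_eval_derivative_le_of_mem_Icc hP hA hmax' hz
    rwa [sub_zero, one_div, inv_mul_le_iff₀ (by exact_mod_cast hK)] at this
  have hmv := (convex_Icc (0 : ℝ) (1 / (8 * q ^ 2 : ℕ))).norm_image_sub_le_of_norm_hasDerivWithin_le
    (fun z _ => (P.hasDerivAt z).hasDerivWithinAt) hder hNmem hy
  rw [Real.norm_eq_abs, Real.norm_eq_abs] at hmv
  have hhalf : |P.eval y - P.eval (1 / (N : ℝ))| ≤ |P.eval y| / 2 := by
    refine (hmv.trans (mul_le_mul_of_nonneg_left hdist (by positivity))).trans_eq ?_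
    have : (q : ℝ) ≠ 0 := by positivity
    push_cast
    field_simp
    norm_num
  linarith [abs_sub_abs_le_abs_sub (P.eval y) (P.eval (1 / (N : ℝ))), h N hN]

/-- The key estimate of the polynomial method: a polynomial of degree `q` that is bounded by `M`
at all points `1/N`, `N = 1, 2, 3, …`, has derivative at `0` bounded by `C·q⁴·M`. -/
theorem derivative_bound_of_bounded_on_inv_nat :
    ∃ C : ℝ, 0 < C ∧
      ∀ q : ℕ, 1 ≤ q → ∀ M : ℝ, 0 ≤ M → ∀ Φ : Polynomial ℝ, Φ.natDegree ≤ q →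
        (∀ N : ℕ, 0 < N → |Φ.eval (1 / (N : ℝ))| ≤ M) →
        |(Polynomial.derivative Φ).eval 0| ≤ C * (q : ℝ) ^ 4 * M := by
  refine ⟨32, by norm_num, fun q hq M hM Φ hΦ h => ?_⟩
  have hq' : (0 : ℝ) < q := by exact_mod_cast hq
  have key : ∀ B : ℝ, M < B → |(derivative Φ).eval 0| ≤ 32 * (q : ℝ) ^ 4 * B := fun B hB => by
    have := abs_eval_left_derivative_le hΦ (a := 0) (b := 1 / (8 * q ^ 2 : ℕ)) (A := 2 * B)
      (by linarith) (by positivity) fun x hx =>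
        (abs_eval_le_two_mul_of_bounded_on_inv_nat hq hM hΦ h hx).trans (by linarith)
    rw [sub_zero, one_div, inv_mul_le_iff₀ (by positivity)] at this
    push_cast at this
    linarith
  rw [← div_le_iff₀' (by positivity)]
  refine le_of_forall_gt_imp_ge_of_dense fun B hB => ?_
  rw [div_le_iff₀' (by positivity)]
  exact key B hB
end

section
/- Let μ be a finite signed measure on ℝ with compact support, and set ρ = limsup_{p→∞} |∫ x^p dμ(x)|^{1/p}. Then the support of μ is contained in the interval [−ρ, ρ]. -/
/-!
Statement 12: a finite signed measure `μ` on `ℝ` with compact support has support contained in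
`[-ρ, ρ]`, where `ρ = limsup_{p→∞} |∫ x^p dμ(x)|^{1/p}`.

The integral of `f` against the signed measure `μ` is taken, via the Jordan decomposition
`μ = μ⁺ − μ⁻`, as `∫ f dμ⁺ − ∫ f dμ⁻`.  The statement that a closed set `F` carries `μ`
(i.e. the complement of `F` has `|μ|`-measure zero) is expressed by saying that every measurable
set disjoint from `F` has `μ`-measure zero.
-/

open MeasureTheory Filter

/-- Integration of a real function against a finite signed measure on `ℝ`, via the Jordan
decomposition. -/
noncomputable def signedIntegral (μ : MeasureTheory.SignedMeasure ℝ) (f : ℝ → ℝ) : ℝ :=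
  (∫ x, f x ∂μ.toJordanDecomposition.posPart) - ∫ x, f x ∂μ.toJordanDecomposition.negPart

open Topology NNReal

section CompactlySupported

variable {μ ν : Measure ℝ} [IsFiniteMeasure μ] [IsFiniteMeasure ν] {R a r : ℝ}

lemma integrable_of_continuous_of_ae_abs_le (hμ : ∀ᵐ x ∂μ, |x| ≤ R) {f : ℝ → ℝ}
    (hf : Continuous f) : Integrable f μ := by
  obtain ⟨C, hC⟩ := (isCompact_Icc (a := -R) (b := R)).exists_bound_of_continuousOn hf.continuousOn
  refine Integrable.of_bound hf.aestronglyMeasurable C ?_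
  filter_upwards [hμ] with x hx using hC x (abs_le.mp hx)

lemma integral_eval_eq_of_moments_eq (hμ : ∀ᵐ x ∂μ, |x| ≤ R) (hν : ∀ᵐ x ∂ν, |x| ≤ R)
    (h : ∀ j : ℕ, ∫ x, x ^ j ∂μ = ∫ x, x ^ j ∂ν) (p : Polynomial ℝ) :
    ∫ x, p.eval x ∂μ = ∫ x, p.eval x ∂ν := by
  simp_rw [Polynomial.eval_eq_sum_range]
  rw [integral_finsetSum _ fun j _ =>
      integrable_of_continuous_of_ae_abs_le hμ (by fun_prop),
    integral_finsetSum _ fun j _ =>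
      integrable_of_continuous_of_ae_abs_le hν (by fun_prop)]
  simp_rw [integral_const_mul, h]

/-- A compactly supported finite measure on the line is determined by its moments. -/
lemma measure_eq_of_moments_eq (hμ : ∀ᵐ x ∂μ, |x| ≤ R) (hν : ∀ᵐ x ∂ν, |x| ≤ R)
    (h : ∀ j : ℕ, ∫ x, x ^ j ∂μ = ∫ x, x ^ j ∂ν) : μ = ν := by
  refine ext_of_forall_integral_eq_of_IsFiniteMeasure fun f => ?_
  have approx (m : Measure ℝ) [IsFiniteMeasure m] (hm : ∀ᵐ x ∂m, |x| ≤ R) {ε : ℝ}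
      {p : Polynomial ℝ} (hp : ∀ x ∈ Set.Icc (-R) R, |p.eval x - f x| < ε) :
      |∫ x, p.eval x ∂m - ∫ x, f x ∂m| ≤ ε * m.real Set.univ := by
    rw [← integral_sub (integrable_of_continuous_of_ae_abs_le hm p.continuous)
      (integrable_of_continuous_of_ae_abs_le hm f.continuous)]
    rw [← Real.norm_eq_abs]
    refine norm_integral_le_of_norm_le_const ?_
    filter_upwards [hm] with x hx using (hp x (abs_le.mp hx)).le
  refine eq_of_abs_sub_le_all fun ε hε => ?_
  set M := μ.real Set.univ + ν.real Set.univ + 1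
  have hMpos : 0 < M := by positivity
  obtain ⟨p, hp⟩ := exists_polynomial_near_of_continuousOn (-R) R f f.continuous.continuousOn
    (ε / M) (by positivity)
  have h₁ := approx μ hμ hp
  have h₂ := approx ν hν hp
  rw [← integral_eval_eq_of_moments_eq hμ hν h p] at h₂
  have h₃ : ε / M * M = ε := by field_simp
  have h₄ : 0 < ε / M := by positivity
  rw [abs_le] at *
  constructor <;> nlinarith

lemma hasSum_integral_pow_mul_exp (hμ : ∀ᵐ x ∂μ, |x| ≤ R) (a : ℝ) (j n : ℕ) :
    HasSum (fun k : ℕ => (-1) ^ k / (k.factorial * a ^ (n * k)) * ∫ x, x ^ (j + n * k) ∂μ)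
      (∫ x, x ^ j * Real.exp (-(x / a) ^ n) ∂μ) := by
  have key (x : ℝ) : HasSum (fun k : ℕ => (-1) ^ k / (k.factorial * a ^ (n * k)) * x ^ (j + n * k))
      (x ^ j * Real.exp (-(x / a) ^ n)) := by
    have := (NormedSpace.expSeries_div_hasSum_exp (-(x / a) ^ n)).mul_left (x ^ j)
    rw [← Real.exp_eq_exp_ℝ] at this
    refine this.congr_fun fun k => ?_
    rw [neg_pow ((x / a) ^ n), ← pow_mul, div_pow, pow_add]
    ring
  have hint (k : ℕ) :
      Integrable (fun x : ℝ => (-1) ^ k / (k.factorial * a ^ (n * k)) * x ^ (j + n * k)) μ :=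
    integrable_of_continuous_of_ae_abs_le hμ (by fun_prop)
  have hsum : Summable fun k : ℕ =>
      ∫ x, ‖(-1) ^ k / (k.factorial * a ^ (n * k)) * x ^ (j + n * k)‖ ∂μ := by
    refine Summable.of_nonneg_of_le (fun k => integral_nonneg fun x => norm_nonneg _) (fun k => ?_)
      ((Real.summable_pow_div_factorial ((|R| / |a|) ^ n)).mul_left (|R| ^ j * μ.real Set.univ))
    refine (Real.le_norm_self _).trans ((norm_integral_le_of_norm_le_const (μ := μ)
      (C := |R| ^ j * (((|R| / |a|) ^ n) ^ k / k.factorial)) ?_).trans_eq (mul_right_comm ..))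
    simp only [norm_norm]
    filter_upwards [hμ] with x hx
    have hx' : |x| ≤ |R| := hx.trans (le_abs_self R)
    calc _ = |x| ^ (j + n * k) / (k.factorial * |a| ^ (n * k)) := by
          simp; ring
      _ ≤ |R| ^ (j + n * k) / (k.factorial * |a| ^ (n * k)) := by gcongr
      _ = _ := by rw [← pow_mul, div_pow, pow_add]; ring
  have := hasSum_integral_of_summable_integral_norm hint hsum
  simp_rw [integral_const_mul, (key _).tsum_eq] at this
  exact this

/-- The pointwise limit of `x ↦ exp (-(x / a) ^ (2 * m))` as `m → ∞`. -/
noncomputable def expCutoff (a x : ℝ) : ℝ≥0 :=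
  if |x| < a then 1 else if |x| = a then (Real.exp (-1)).toNNReal else 0

lemma measurable_expCutoff (a : ℝ) : Measurable (expCutoff a) :=
  Measurable.ite (measurableSet_lt measurable_id.abs measurable_const) measurable_const
    (Measurable.ite (measurableSet_eq_fun measurable_id.abs measurable_const) measurable_const
      measurable_const)

lemma expCutoff_le_one (a x : ℝ) : expCutoff a x ≤ 1 := by
  unfold expCutoff
  split_ifs <;> simp

lemma expCutoff_eq_zero {x : ℝ} (h : a < |x|) : expCutoff a x = 0 := by
  simp [expCutoff, h.not_gt, h.ne']

lemma tendsto_exp_neg_div_pow (ha : 0 < a) (x : ℝ) :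
    Tendsto (fun m : ℕ => Real.exp (-(x / a) ^ (2 * m))) atTop (𝓝 (expCutoff a x)) := by
  have hpow (m : ℕ) : (x / a) ^ (2 * m) = ((|x| / a) ^ 2) ^ m := by
    rw [pow_mul, div_pow x, div_pow |x|, sq_abs]
  simp_rw [hpow]
  rcases lt_trichotomy |x| a with h | h | h
  · have h0 : Tendsto (fun m : ℕ => ((|x| / a) ^ 2) ^ m) atTop (𝓝 0) :=
      tendsto_pow_atTop_nhds_zero_of_lt_one (by positivity)
        (pow_lt_one₀ (by positivity) ((div_lt_one ha).2 h) two_ne_zero)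
    simpa [expCutoff, h, Function.comp_def] using (Real.continuous_exp.tendsto _).comp h0.neg
  · simp [expCutoff, h, div_self ha.ne', Real.exp_nonneg]
  · have h0 : Tendsto (fun m : ℕ => ((|x| / a) ^ 2) ^ m) atTop atTop :=
      tendsto_pow_atTop_atTop_of_one_lt (one_lt_pow₀ ((one_lt_div ha).2 h) two_ne_zero)
    rw [expCutoff_eq_zero h]
    exact Real.tendsto_exp_neg_atTop_nhds_zero.comp h0

lemma tendsto_integral_pow_mul_exp (hμ : ∀ᵐ x ∂μ, |x| ≤ R) (ha : 0 < a) (j : ℕ) :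
    Tendsto (fun m : ℕ => ∫ x, x ^ j * Real.exp (-(x / a) ^ (2 * m)) ∂μ) atTop
      (𝓝 (∫ x, x ^ j ∂(μ.withDensity fun x => expCutoff a x))) := by
  rw [integral_withDensity_eq_integral_smul (measurable_expCutoff a)]
  refine tendsto_integral_of_dominated_convergence (fun x => |x ^ j|)
    (fun m => by fun_prop)
    (integrable_of_continuous_of_ae_abs_le hμ (by fun_prop))
    (fun m => Eventually.of_forall fun x => ?_) (Eventually.of_forall fun x => ?_)
  · rw [norm_mul, Real.norm_eq_abs, Real.norm_eq_abs, Real.abs_exp]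
    refine mul_le_of_le_one_right (abs_nonneg _) (Real.exp_le_one_iff.2 ?_)
    have : 0 ≤ (x / a) ^ (2 * m) := by rw [pow_mul]; positivity
    linarith
  · rw [NNReal.smul_def, smul_eq_mul, mul_comm]
    exact (tendsto_exp_neg_div_pow ha x).const_mul _

lemma abs_integral_sub_pow_mul_exp_le (hμ : ∀ᵐ x ∂μ, |x| ≤ R) (hν : ∀ᵐ x ∂ν, |x| ≤ R)
    (ha : 0 < a) {p₀ : ℕ}
    (h : ∀ p ≥ p₀, |∫ x, x ^ p ∂μ - ∫ x, x ^ p ∂ν| ≤ r ^ p) (j : ℕ) {n : ℕ} (hn : p₀ ≤ n) :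
    |(∫ x, x ^ j * Real.exp (-(x / a) ^ n) ∂μ - ∫ x, x ^ j * Real.exp (-(x / a) ^ n) ∂ν) -
      (∫ x, x ^ j ∂μ - ∫ x, x ^ j ∂ν)| ≤ r ^ j * (Real.exp ((r / a) ^ n) - 1) := by
  have h₁ := (hasSum_nat_add_iff' 1).2
    ((hasSum_integral_pow_mul_exp hμ a j n).sub (hasSum_integral_pow_mul_exp hν a j n))
  have h₂ := (hasSum_nat_add_iff' 1).2
    ((NormedSpace.expSeries_div_hasSum_exp ((r / a) ^ n)).mul_left (r ^ j))
  rw [← Real.exp_eq_exp_ℝ] at h₂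
  have h₃ := h₁.norm_le_of_bounded h₂ fun k => by
    have hp : p₀ ≤ j + n * (k + 1) := by nlinarith [Nat.zero_le (n * k)]
    rw [← mul_sub, norm_mul]
    calc _ ≤ ‖(-1 : ℝ) ^ (k + 1) / ((k + 1).factorial * a ^ (n * (k + 1)))‖ *
          r ^ (j + n * (k + 1)) := mul_le_mul_of_nonneg_left (h _ hp) (norm_nonneg _)
      _ = _ := by
        simp only [norm_div, norm_pow, norm_neg, norm_one, one_pow, norm_mul, Real.norm_eq_abs,
          abs_of_pos ha, Nat.abs_cast]
        rw [← pow_mul, div_pow, pow_add]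
        ring
  simpa [mul_sub] using h₃

/-- If the differences of the moments of two compactly supported measures are `O(r ^ p)`, then the
measures agree outside any interval `[-a, a]` with `a > r`. -/
lemma measure_eq_of_abs_moment_sub_le (hμ : ∀ᵐ x ∂μ, |x| ≤ R) (hν : ∀ᵐ x ∂ν, |x| ≤ R)
    (hr : 0 ≤ r) (hra : r < a) {p₀ : ℕ}
    (h : ∀ p ≥ p₀, |∫ x, x ^ p ∂μ - ∫ x, x ^ p ∂ν| ≤ r ^ p) {B : Set ℝ}
    (hB : MeasurableSet B) (hBa : ∀ x ∈ B, a < |x|) : μ B = ν B := by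
  have ha : 0 < a := hr.trans_lt hra
  let cut (m : Measure ℝ) : Measure ℝ := m.withDensity fun x => expCutoff a x
  have cut_le (m : Measure ℝ) : cut m ≤ m := by
    conv_rhs => rw [← withDensity_one (μ := m)]
    exact withDensity_mono (Eventually.of_forall fun x => by
      simpa using expCutoff_le_one a x)
  have cut_apply (m : Measure ℝ) : cut m B = 0 := by
    rw [withDensity_apply _ hB]
    exact setLIntegral_eq_zero hB fun x hx => by simp [expCutoff_eq_zero (hBa x hx)]
  have : IsFiniteMeasure (cut μ) := isFiniteMeasure_of_le μ (cut_le μ)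
  have : IsFiniteMeasure (cut ν) := isFiniteMeasure_of_le ν (cut_le ν)
  have hcμ : ∀ᵐ x ∂(cut μ), |x| ≤ R := ae_mono (cut_le μ) hμ
  have hcν : ∀ᵐ x ∂(cut ν), |x| ≤ R := ae_mono (cut_le ν) hν
  have moments (j : ℕ) : ∫ x, x ^ j ∂(cut μ) - ∫ x, x ^ j ∂(cut ν)
      = ∫ x, x ^ j ∂μ - ∫ x, x ^ j ∂ν := by
    refine tendsto_nhds_unique ((tendsto_integral_pow_mul_exp hμ ha j).sub
      (tendsto_integral_pow_mul_exp hν ha j)) ?_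
    rw [tendsto_iff_norm_sub_tendsto_zero]
    have hlim : Tendsto (fun m : ℕ => r ^ j * (Real.exp ((r / a) ^ (2 * m)) - 1)) atTop (𝓝 0) := by
      have h0 : Tendsto (fun m : ℕ => (r / a) ^ (2 * m)) atTop (𝓝 0) :=
        (tendsto_pow_atTop_nhds_zero_of_lt_one (by positivity) ((div_lt_one ha).2 hra)).comp
          (tendsto_id.const_mul_atTop' two_pos)
      simpa using (((Real.continuous_exp.tendsto _).comp h0).sub_const 1).const_mul (r ^ j)
    refine squeeze_zero' (Eventually.of_forall fun m => norm_nonneg _) ?_ hlim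
    filter_upwards [eventually_ge_atTop p₀] with m hm
    exact abs_integral_sub_pow_mul_exp_le hμ hν ha h j (by omega)
  have hadd : cut μ + ν = cut ν + μ := by
    refine measure_eq_of_moments_eq (R := R) (ae_add_measure_iff.2 ⟨hcμ, hν⟩)
      (ae_add_measure_iff.2 ⟨hcν, hμ⟩) fun j => ?_
    have hint {m : Measure ℝ} [IsFiniteMeasure m] (hm : ∀ᵐ x ∂m, |x| ≤ R) :
        Integrable (fun x : ℝ => x ^ j) m :=
      integrable_of_continuous_of_ae_abs_le hm (by fun_prop)
    rw [integral_add_measure (hint hcμ) (hint hν), integral_add_measure (hint hcν) (hint hμ)]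
    linarith [moments j]
  have := congrArg (fun m : Measure ℝ => m B) hadd
  simpa [cut_apply] using this.symm

lemma abs_integral_pow_le (hμ : ∀ᵐ x ∂μ, |x| ≤ R) (p : ℕ) :
    |∫ x, x ^ p ∂μ| ≤ R ^ p * μ.real Set.univ := by
  rw [← Real.norm_eq_abs]
  refine norm_integral_le_of_norm_le_const ?_
  filter_upwards [hμ] with x hx
  rw [norm_pow]
  exact pow_le_pow_left₀ (abs_nonneg x) hx p

lemma isBoundedUnder_abs_moment_sub_rpow (hμ : ∀ᵐ x ∂μ, |x| ≤ R) (hν : ∀ᵐ x ∂ν, |x| ≤ R)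
    (hR : 0 ≤ R) : IsBoundedUnder (· ≤ ·) atTop
      fun p : ℕ => |∫ x, x ^ p ∂μ - ∫ x, x ^ p ∂ν| ^ ((1 : ℝ) / p) := by
  set C := μ.real Set.univ + ν.real Set.univ + 1
  have hC : 1 ≤ C := by
    have : 0 ≤ μ.real Set.univ + ν.real Set.univ := by positivity
    linarith
  refine isBoundedUnder_of_eventually_le (a := C * R) ?_
  filter_upwards [eventually_ge_atTop 1] with p hp
  rw [one_div, Real.rpow_inv_le_iff_of_pos (abs_nonneg _) (by positivity) (by positivity),
    Real.rpow_natCast]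
  calc |∫ x, x ^ p ∂μ - ∫ x, x ^ p ∂ν|
      ≤ R ^ p * μ.real Set.univ + R ^ p * ν.real Set.univ :=
        (abs_sub _ _).trans (add_le_add (abs_integral_pow_le hμ p) (abs_integral_pow_le hν p))
    _ ≤ C * R ^ p := by nlinarith [pow_nonneg hR p]
    _ ≤ C ^ p * R ^ p := by gcongr; exact le_self_pow₀ hC (by omega)
    _ = (C * R) ^ p := (mul_pow ..).symm

end CompactlySupported

lemma jordanDecomposition_ae_mem {K : Set ℝ} {μ : SignedMeasure ℝ} (hK : MeasurableSet K)
    (h : ∀ B : Set ℝ, MeasurableSet B → Disjoint B K → μ B = 0) :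
    (∀ᵐ x ∂μ.toJordanDecomposition.posPart, x ∈ K) ∧
      ∀ᵐ x ∂μ.toJordanDecomposition.negPart, x ∈ K := by
  obtain ⟨i, hi, hi₂, hi₃, hpos, hneg⟩ := μ.toJordanDecomposition_spec
  have h0 (s : Set ℝ) (hs : MeasurableSet s) : μ (s ∩ Kᶜ) = 0 :=
    h _ (hs.inter hK.compl) (disjoint_compl_left.mono_left Set.inter_subset_right)
  simp_rw [ae_iff, ← Set.compl_def]
  constructor
  · rw [hpos, SignedMeasure.toMeasureOfZeroLE_apply _ _ _ hK.compl]
    simp [h0 i hi]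
  · rw [hneg, SignedMeasure.toMeasureOfLEZero_apply _ _ _ hK.compl]
    simp [h0 iᶜ hi.compl]

/-- The moment criterion for the support of a compactly supported finite signed measure:
`supp μ ⊆ [-ρ, ρ]` with `ρ = limsup_p |∫ x^p dμ|^{1/p}`. -/
theorem support_subset_of_moment_growth
    (μ : MeasureTheory.SignedMeasure ℝ)
    (hcomp : ∃ K : Set ℝ, IsCompact K ∧
      ∀ B : Set ℝ, MeasurableSet B → Disjoint B K → μ B = 0) :
    ∀ B : Set ℝ, MeasurableSet B →
      Disjoint B (Set.Icc (-(limsup (fun p : ℕ => |signedIntegral μ (fun x => x ^ p)| ^ ((1 : ℝ) / p)) atTop))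
        (limsup (fun p : ℕ => |signedIntegral μ (fun x => x ^ p)| ^ ((1 : ℝ) / p)) atTop)) →
      μ B = 0 := by
  intro B hB hdisj
  obtain ⟨K, hK, hKμ⟩ := hcomp
  obtain ⟨R, hR, hKR⟩ := hK.isBounded.exists_pos_norm_le
  obtain ⟨hpos, hneg⟩ := jordanDecomposition_ae_mem hK.measurableSet hKμ
  replace hpos : ∀ᵐ x ∂μ.toJordanDecomposition.posPart, |x| ≤ R := hpos.mono hKR
  replace hneg : ∀ᵐ x ∂μ.toJordanDecomposition.negPart, |x| ≤ R := hneg.mono hKR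
  have hbdd := isBoundedUnder_abs_moment_sub_rpow hpos hneg hR.le
  change IsBoundedUnder _ _
    (fun p : ℕ => |signedIntegral μ (fun x => x ^ p)| ^ ((1 : ℝ) / p)) at hbdd
  set ρ := limsup (fun p : ℕ => |signedIntegral μ (fun x => x ^ p)| ^ ((1 : ℝ) / p)) atTop
  have hρ0 : 0 ≤ ρ :=
    le_limsup_of_frequently_le (Frequently.of_forall fun p => by positivity) hbdd
  have agree {a : ℝ} (ha : ρ < a) {s : Set ℝ} (hs : MeasurableSet s) (hsa : ∀ x ∈ s, a < |x|) :
      μ.toJordanDecomposition.posPart s = μ.toJordanDecomposition.negPart s := by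
    obtain ⟨r, hρr, hra⟩ := exists_between ha
    have hr : 0 < r := hρ0.trans_lt hρr
    obtain ⟨p₀, hp₀⟩ := eventually_atTop.1
      ((eventually_lt_of_limsup_lt hρr hbdd).and (eventually_ge_atTop 1))
    refine measure_eq_of_abs_moment_sub_le hpos hneg hr.le hra (p₀ := p₀) (fun p hp => ?_) hs hsa
    obtain ⟨hlt, hp1⟩ := hp₀ p hp
    rw [one_div] at hlt
    have := (Real.rpow_inv_le_iff_of_pos (abs_nonneg _) hr.le (by positivity)).1 hlt.le
    rwa [Real.rpow_natCast] at this
  let s (n : ℕ) : Set ℝ := B ∩ {x | ρ + 1 / (n + 1) < |x|}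
  have hs_mono : Monotone s := fun m n hmn x hx =>
    ⟨hx.1, (add_le_add_right (Nat.one_div_le_one_div hmn) ρ).trans_lt hx.2⟩
  have hs_union : ⋃ n, s n = B := by
    refine Set.Subset.antisymm (Set.iUnion_subset fun n => Set.inter_subset_left) fun x hx => ?_
    have hxρ : ρ < |x| := by
      by_contra! hle
      exact Set.disjoint_left.1 hdisj hx (abs_le.1 hle)
    obtain ⟨n, hn⟩ := exists_nat_one_div_lt (sub_pos.2 hxρ)
    exact Set.mem_iUnion.2 ⟨n, hx, by change ρ + 1 / ((n : ℝ) + 1) < |x|; linarith⟩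
  have hs_agree (n : ℕ) := agree (s := s n) (lt_add_of_pos_right ρ Nat.one_div_pos_of_nat)
    (hB.inter (measurableSet_lt measurable_const measurable_id.abs)) fun x hx => hx.2
  rw [μ.apply_eq_posPart_real_sub_negPart_real hB, measureReal_def, measureReal_def, ← hs_union,
    hs_mono.measure_iUnion, hs_mono.measure_iUnion]
  simp_rw [hs_agree, sub_self]
end
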